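/- Let f ∈ RBMO(μ) and let φ be a C¹ function with compact support on ℝ^d. Then the pointwise product fφ belongs to RBMO(μ). -/

import Mathlib

open MeasureTheory Metric Set Filter
open scoped ENNReal NNReal BigOperators Topology

noncomputable section

/-- Euclidean space `ℝ^d`. -/
abbrev Euc (d : ℕ) := EuclideanSpace ℝ (Fin d)

/-- A (closed, axis-parallel) cube in `ℝ^d`, given by its center and side length. -/
structure Cube (d : ℕ) where
  center : Euc d
  side : ℝ

namespace Cube

/-- The underlying set of a cube. -/
def set {d : ℕ} (Q : Cube d) : Set (Euc d) :=
  {y : Euc d | ∀ i, |y i - Q.center i| ≤ Q.side / 2}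

/-- The concentric dilate `αQ` of a cube. -/
def dilate {d : ℕ} (Q : Cube d) (α : ℝ) : Cube d := ⟨Q.center, α * Q.side⟩

end Cube

/-- `Q` is a genuine cube for `μ`: positive side length, centered at a point of `supp μ`. -/
def IsCube {d : ℕ} (μ : Measure (Euc d)) (Q : Cube d) : Prop :=
  0 < Q.side ∧ ∀ r : ℝ, 0 < r → 0 < μ (Metric.ball Q.center r)

/-- The mean value `f_Q = μ(Q)⁻¹ ∫_Q f dμ`. -/
def cubeAvg {d : ℕ} (μ : Measure (Euc d)) (Q : Cube d) (f : Euc d → ℝ) : ℝ :=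
  (μ Q.set).toReal⁻¹ * ∫ x in Q.set, f x ∂μ

/-- `N_{Q,R}`: the smallest positive integer `k` with `2^k ℓ(Q) ≥ ℓ(R)`. -/
def NQR {d : ℕ} (Q R : Cube d) : ℕ :=
  sInf {k : ℕ | 0 < k ∧ R.side ≤ 2 ^ k * Q.side}

/-- The Tolsa coefficient `S_{Q,R} = 1 + ∑_{k=1}^{N_{Q,R}} μ(2^k Q)/ℓ(2^k Q)^n`. -/
def SQR {d : ℕ} (μ : Measure (Euc d)) (n : ℕ) (Q R : Cube d) : ℝ :=
  1 + ∑ k ∈ Finset.Icc 1 (NQR Q R),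
      (μ (Q.dilate (2 ^ k)).set).toReal / (2 ^ k * Q.side) ^ n

/-- `Q` is `(α,β)`-doubling: `μ(αQ) ≤ β μ(Q)`. -/
def IsDoubling {d : ℕ} (μ : Measure (Euc d)) (α β : ℝ) (Q : Cube d) : Prop :=
  μ (Q.dilate α).set ≤ ENNReal.ofReal β * μ Q.set

/-- `Q̃ = 2^N Q`, `N` the smallest non-negative integer making `2^N Q` `(ρ,β)`-doubling. -/
def tilde {d : ℕ} (μ : Measure (Euc d)) (ρ β : ℝ) (Q : Cube d) : Cube d :=
  Q.dilate (2 ^ sInf {N : ℕ | IsDoubling μ ρ β (Q.dilate (2 ^ N))})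

/-- `C` is an `RBMO(μ)` bound for `f` (with parameters `η, ρ, β`). -/
def RBMOBound {d : ℕ} (μ : Measure (Euc d)) (n : ℕ) (η ρ β : ℝ)
    (f : Euc d → ℝ) (C : ℝ) : Prop :=
  (∀ Q : Cube d, IsCube μ Q →
      ∫ x in Q.set, |f x - cubeAvg μ (tilde μ ρ β Q) f| ∂μ
        ≤ C * (μ (Q.dilate η).set).toReal) ∧
  (∀ Q R : Cube d, IsCube μ Q → IsCube μ R → Q.set ⊆ R.set →
      IsDoubling μ ρ β Q → IsDoubling μ ρ β R →
      |cubeAvg μ Q f - cubeAvg μ R f| ≤ C * SQR μ n Q R)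

/-- `f ∈ RBMO(μ)`. -/
def MemRBMO {d : ℕ} (μ : Measure (Euc d)) (n : ℕ) (η ρ β : ℝ) (f : Euc d → ℝ) : Prop :=
  LocallyIntegrable f μ ∧ ∃ C : ℝ, 0 ≤ C ∧ RBMOBound μ n η ρ β f C

/-- The `RBMO(μ)` norm of `f`. -/
def rbmoNorm {d : ℕ} (μ : Measure (Euc d)) (n : ℕ) (η ρ β : ℝ) (f : Euc d → ℝ) : ℝ :=
  sInf {C : ℝ | 0 ≤ C ∧ RBMOBound μ n η ρ β f C}

/-- `C` is an `rbmo(μ)` (local `RBMO`) bound for `f`. -/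
def RbmoLocBound {d : ℕ} (μ : Measure (Euc d)) (n : ℕ) (η ρ β : ℝ)
    (f : Euc d → ℝ) (C : ℝ) : Prop :=
  (∀ Q : Cube d, IsCube μ Q → Q.side ≤ 1 →
      ∫ x in Q.set, |f x - cubeAvg μ (tilde μ ρ β Q) f| ∂μ
        ≤ C * (μ (Q.dilate η).set).toReal) ∧
  (∀ Q R : Cube d, IsCube μ Q → IsCube μ R → Q.side ≤ 1 → Q.set ⊆ R.set →
      IsDoubling μ ρ β Q → IsDoubling μ ρ β R →
      |cubeAvg μ Q f - cubeAvg μ R f| ≤ C * SQR μ n Q R) ∧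
  (∀ Q : Cube d, IsCube μ Q → 1 < Q.side →
      ∫ x in Q.set, |f x| ∂μ ≤ C * (μ (Q.dilate η).set).toReal)

/-- `f ∈ rbmo(μ)`. -/
def MemRbmoLoc {d : ℕ} (μ : Measure (Euc d)) (n : ℕ) (η ρ β : ℝ) (f : Euc d → ℝ) : Prop :=
  LocallyIntegrable f μ ∧ ∃ C : ℝ, 0 ≤ C ∧ RbmoLocBound μ n η ρ β f C

/-- The `rbmo(μ)` norm of `f`. -/
def rbmoLocNorm {d : ℕ} (μ : Measure (Euc d)) (n : ℕ) (η ρ β : ℝ) (f : Euc d → ℝ) : ℝ :=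
  sInf {C : ℝ | 0 ≤ C ∧ RbmoLocBound μ n η ρ β f C}

/-- The data of an `∞`-block: `b = ∑ λ_j a_j`, supported in `R`, with `a_j` supported
in `Q_j ⊂ R` and `‖a_j‖_{L^∞(μ)} ≤ (μ(2Q_j) S_{Q_j,R})⁻¹`, `∑_j |λ_j| < ∞`. -/
structure PreBlock {d : ℕ} (μ : Measure (Euc d)) (n : ℕ) : Type where
  R : Cube d
  Qs : ℕ → Cube d
  lam : ℕ → ℝ
  a : ℕ → Euc d → ℝ
  isCubeR : IsCube μ R
  isCubeQs : ∀ j, IsCube μ (Qs j)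
  subsetQR : ∀ j, (Qs j).set ⊆ R.set
  measA : ∀ j, Measurable (a j)
  suppA : ∀ j, Function.support (a j) ⊆ (Qs j).set
  boundA : ∀ j x, |a j x| ≤ ((μ ((Qs j).dilate 2).set).toReal * SQR μ n (Qs j) R)⁻¹
  summable : Summable fun j => |lam j|

/-- The function determined by a block. -/
def PreBlock.fn {d : ℕ} {μ : Measure (Euc d)} {n : ℕ} (b : PreBlock μ n) : Euc d → ℝ :=
  fun x => ∑' j, b.lam j * b.a j x

/-- `|b| = ∑_j |λ_j|`. -/
def PreBlock.size {d : ℕ} {μ : Measure (Euc d)} {n : ℕ} (b : PreBlock μ n) : ℝ :=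
  ∑' j, |b.lam j|

/-- An `∞`-atomic block: an `∞`-block with vanishing integral. -/
structure AtomicBlock {d : ℕ} (μ : Measure (Euc d)) (n : ℕ) extends PreBlock μ n where
  cancel : ∫ x, (∑' j, lam j * a j x) ∂μ = 0

/-- The function determined by an atomic block. -/
def AtomicBlock.fn {d : ℕ} {μ : Measure (Euc d)} {n : ℕ} (b : AtomicBlock μ n) : Euc d → ℝ :=
  b.toPreBlock.fn

/-- `|b|_{H¹} = ∑_j |λ_j|`. -/
def AtomicBlock.size {d : ℕ} {μ : Measure (Euc d)} {n : ℕ} (b : AtomicBlock μ n) : ℝ :=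
  b.toPreBlock.size

/-- The class of test functions `F(x)` of Tolsa's grand maximal function. -/
def TestFun {d : ℕ} (μ : Measure (Euc d)) (n : ℕ) (x : Euc d) (φ : Euc d → ℝ) : Prop :=
  Integrable φ μ ∧ ContDiff ℝ 1 φ ∧ (∫ y, |φ y| ∂μ) ≤ 1 ∧
  (∀ y, 0 ≤ φ y) ∧ (∀ y, y ≠ x → φ y ≤ (‖y - x‖ ^ n)⁻¹) ∧
  (∀ y, y ≠ x → ‖fderiv ℝ φ y‖ ≤ (‖y - x‖ ^ (n + 1))⁻¹)

/-- The grand maximal function `M f(x) = sup_{φ ∈ F(x)} |∫ f φ dμ|`. -/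
def grandM {d : ℕ} (μ : Measure (Euc d)) (n : ℕ) (f : Euc d → ℝ) (x : Euc d) : ℝ :=
  sSup {r : ℝ | ∃ φ : Euc d → ℝ, TestFun μ n x φ ∧ r = |∫ y, f y * φ y ∂μ|}

/-- The local class `F_loc(x)`: test functions supported in the cube `Q(x,1)`. -/
def TestFunLoc {d : ℕ} (μ : Measure (Euc d)) (n : ℕ) (x : Euc d) (φ : Euc d → ℝ) : Prop :=
  TestFun μ n x φ ∧ Function.support φ ⊆ (Cube.mk x 1).set

/-- The local grand maximal function `M^{(1)} f(x) = sup_{φ ∈ F_loc(x)} |∫ f φ dμ|`. -/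
def grandMLoc {d : ℕ} (μ : Measure (Euc d)) (n : ℕ) (f : Euc d → ℝ) (x : Euc d) : ℝ :=
  sSup {r : ℝ | ∃ φ : Euc d → ℝ, TestFunLoc μ n x φ ∧ r = |∫ y, f y * φ y ∂μ|}

/-- The Orlicz quasi-norm of `u` on the set `E`, for the Orlicz function `P`
(with value `∞` when no admissible constant exists). -/
def orliczNormOn {α : Type*} [MeasurableSpace α] (P : ℝ → ℝ) (lam : Measure α)
    (E : Set α) (u : α → ℝ) : ℝ≥0∞ :=
  sInf {k : ℝ≥0∞ | 0 < k ∧ k ≠ ∞ ∧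
    ∫⁻ x in E, ENNReal.ofReal (P (|u x| / k.toReal)) ∂lam ≤ 1}

/-- The Orlicz quasi-norm of `u`. -/
def orliczNorm {α : Type*} [MeasurableSpace α] (P : ℝ → ℝ) (lam : Measure α)
    (u : α → ℝ) : ℝ≥0∞ :=
  orliczNormOn P lam Set.univ u

/-- `℘(t) = t / log(e+t)`. -/
def wp (t : ℝ) : ℝ := t / Real.log (Real.exp 1 + t)

/-- `℘̃(t) = t · log(e+t)`. -/
def wpDual (t : ℝ) : ℝ := t * Real.log (Real.exp 1 + t)

/-- `Ξ(t) = e^t − 1`. -/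
def XiFun (t : ℝ) : ℝ := Real.exp t - 1

/-- `dν(x) = dμ(x)/log(e+|x|)`. -/
def nuMeas {d : ℕ} (μ : Measure (Euc d)) : Measure (Euc d) :=
  μ.withDensity fun x => ENNReal.ofReal (Real.log (Real.exp 1 + ‖x‖))⁻¹

/-- `dσ(x) = dμ(x)/(1+|x|)^{2n+κ}`. -/
def sigmaMeas {d : ℕ} (μ : Measure (Euc d)) (n : ℕ) (κ : ℝ) : Measure (Euc d) :=
  μ.withDensity fun x => ENNReal.ofReal (((1 + ‖x‖) ^ (2 * (n : ℝ) + κ))⁻¹)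

/-- The unit cube `m + [0,1)^d` of the lattice `ℤ^d`. -/
def latCube (d : ℕ) (m : Fin d → ℤ) : Set (Euc d) :=
  {x : Euc d | ∀ i, (m i : ℝ) ≤ x i ∧ x i < (m i : ℝ) + 1}

namespace Cube

variable {d : ℕ}

lemma abs_apply_le_norm (x : Euc d) (i : Fin d) : |x i| ≤ ‖x‖ := by
  simpa using PiLp.norm_apply_le x i

lemma norm_le_of_abs_apply_le {x : Euc d} {a : ℝ} (h : ∀ i, |x i| ≤ a) :
    ‖x‖ ≤ d * a := by
  have hs : ‖x‖ ≤ ∑ i, |x i| := by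
    rw [EuclideanSpace.norm_eq]
    refine Real.sqrt_le_iff.2 ⟨Finset.sum_nonneg fun i _ => abs_nonneg _, ?_⟩
    simpa using Finset.sum_sq_le_sq_sum_of_nonneg (s := Finset.univ)
      (f := fun i => |x i|) fun i _ => abs_nonneg _
  refine hs.trans ((Finset.sum_le_sum fun i _ => h i).trans ?_)
  simp

lemma norm_sub_le_of_mem {Q : Cube d} {x y : Euc d} (hx : x ∈ Q.set) (hy : y ∈ Q.set) :
    ‖x - y‖ ≤ d * Q.side := by
  refine norm_le_of_abs_apply_le fun i => ?_
  have h1 := abs_le.1 (hx i)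
  have h2 := abs_le.1 (hy i)
  rw [PiLp.sub_apply, abs_le]
  constructor <;> linarith [h1.1, h1.2, h2.1, h2.2]

lemma center_mem_set {Q : Cube d} (hQ : 0 ≤ Q.side) : Q.center ∈ Q.set := fun i => by
  simpa using div_nonneg hQ zero_le_two

lemma norm_le_of_mem {Q : Cube d} (hQ : 0 ≤ Q.side) {x : Euc d} (hx : x ∈ Q.set) :
    ‖x‖ ≤ ‖Q.center‖ + d * Q.side := by
  have h := norm_sub_le_of_mem hx (center_mem_set hQ)
  have := norm_le_norm_add_norm_sub' x Q.center
  linarith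

lemma norm_center_le_of_mem {Q : Cube d} (hQ : 0 ≤ Q.side) {x : Euc d} (hx : x ∈ Q.set) :
    ‖Q.center‖ ≤ ‖x‖ + d * Q.side := by
  have h := norm_sub_le_of_mem (center_mem_set hQ) hx
  have := norm_le_norm_add_norm_sub' Q.center x
  linarith

lemma isClosed_set (Q : Cube d) : IsClosed Q.set := by
  have : Q.set = ⋂ i, {y : Euc d | |y i - Q.center i| ≤ Q.side / 2} := by
    ext y; simp [Cube.set]
  rw [this]
  exact isClosed_iInter fun i => isClosed_le (by fun_prop) continuous_const

lemma measurableSet_set (Q : Cube d) : MeasurableSet Q.set := Q.isClosed_set.measurableSet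

lemma isCompact_set {Q : Cube d} (hQ : 0 ≤ Q.side) : IsCompact Q.set := by
  refine (isCompact_closedBall (0 : Euc d) (‖Q.center‖ + d * Q.side)).of_isClosed_subset
    Q.isClosed_set fun x hx => ?_
  simpa using norm_le_of_mem hQ hx

lemma ball_subset_set (Q : Cube d) : ball Q.center (Q.side / 2) ⊆ Q.set := fun y hy i => by
  rw [mem_ball, dist_eq_norm] at hy
  have := abs_apply_le_norm (y - Q.center) i
  rw [PiLp.sub_apply] at this
  linarith

lemma ball_subset_dilate {Q : Cube d} {θ : ℝ} {x : Euc d} (hx : x ∈ Q.set) :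
    ball x ((θ - 1) * Q.side / 2) ⊆ (Q.dilate θ).set := fun y hy i => by
  rw [mem_ball, dist_eq_norm] at hy
  have h1 := abs_apply_le_norm (y - x) i
  have h2 := hx i
  have h3 := abs_sub_le (y i) (x i) (Q.center i)
  rw [PiLp.sub_apply] at h1
  change |y i - Q.center i| ≤ θ * Q.side / 2
  linarith

lemma set_mono {x : Euc d} {s t : ℝ} (h : s ≤ t) : (Cube.mk x s).set ⊆ (Cube.mk x t).set :=
  fun y hy i => (hy i).trans (by change s / 2 ≤ t / 2; linarith)

lemma subset_dilate {Q : Cube d} (hQ : 0 ≤ Q.side) {α : ℝ} (hα : 1 ≤ α) :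
    Q.set ⊆ (Q.dilate α).set :=
  set_mono (x := Q.center) (s := Q.side) (le_mul_of_one_le_left hQ hα)

lemma dilate_one (Q : Cube d) : Q.dilate 1 = Q := by simp [dilate]

lemma dilate_dilate (Q : Cube d) (α γ : ℝ) : (Q.dilate α).dilate γ = Q.dilate (γ * α) := by
  simp [dilate, mul_assoc]

lemma side_le_of_subset (hd : 0 < d) {Q R : Cube d} (hQ : 0 ≤ Q.side) (h : Q.set ⊆ R.set) :
    Q.side ≤ R.side := by
  let i : Fin d := ⟨0, hd⟩
  have hmem : ∀ t : ℝ, |t| ≤ Q.side / 2 → Q.center + EuclideanSpace.single i t ∈ Q.set := by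
    intro t ht j
    by_cases hj : j = i
    · subst hj; simpa using ht
    · have : (0 : ℝ) ≤ Q.side / 2 := by linarith
      simpa [hj] using this
  have h1 := h (hmem (Q.side / 2) (by rw [abs_of_nonneg (by linarith)])) i
  have h2 := h (hmem (-(Q.side / 2)) (by rw [abs_neg, abs_of_nonneg (by linarith)])) i
  simp only [PiLp.add_apply, PiLp.single_apply, if_true] at h1 h2
  have := (abs_le.1 h1).2
  have := (abs_le.1 h2).1
  linarith

end Cube

section

variable {d n : ℕ} {μ : Measure (Euc d)}

lemma mem_support_iff_ball {x : Euc d} :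
    x ∈ μ.support ↔ ∀ r : ℝ, 0 < r → 0 < μ (ball x r) := by
  rw [Measure.mem_support_iff_forall]
  refine ⟨fun h r hr => h _ (ball_mem_nhds x hr), fun h U hU => ?_⟩
  obtain ⟨r, hr, hrU⟩ := Metric.mem_nhds_iff.1 hU
  exact (h r hr).trans_le (measure_mono hrU)

lemma isCube_mk {x : Euc d} {s : ℝ} (hs : 0 < s) (hx : x ∈ μ.support) : IsCube μ ⟨x, s⟩ :=
  ⟨hs, mem_support_iff_ball.1 hx⟩

lemma IsCube.center_mem_support {Q : Cube d} (hQ : IsCube μ Q) : Q.center ∈ μ.support :=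
  mem_support_iff_ball.2 hQ.2

lemma IsCube.dilate {Q : Cube d} (hQ : IsCube μ Q) {α : ℝ} (hα : 0 < α) :
    IsCube μ (Q.dilate α) :=
  ⟨mul_pos hα hQ.1, hQ.2⟩

lemma integrableOn_cube {g : Euc d → ℝ} (hg : LocallyIntegrable g μ) {Q : Cube d}
    (hQ : 0 ≤ Q.side) : IntegrableOn g Q.set μ :=
  hg.integrableOn_isCompact (Cube.isCompact_set hQ)

lemma integrable_mul_of_hasCompactSupport {f φ : Euc d → ℝ} (hf : LocallyIntegrable f μ)
    (hφ : Continuous φ) (hφc : HasCompactSupport φ) : Integrable (fun x => f x * φ x) μ := by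
  simpa [mul_comm] using hf.integrable_smul_left_of_hasCompactSupport hφ hφc

lemma cubeAvg_eq_zero {g : Euc d → ℝ} {Q : Cube d} (h : ∀ x ∈ Q.set, g x = 0) :
    cubeAvg μ Q g = 0 := by
  rw [cubeAvg, setIntegral_eq_zero_of_forall_eq_zero h, mul_zero]

lemma NQR_mem {Q : Cube d} (hQ : 0 < Q.side) (R : Cube d) :
    0 < NQR Q R ∧ R.side ≤ 2 ^ NQR Q R * Q.side := by
  refine Nat.sInf_mem (s := {k : ℕ | 0 < k ∧ R.side ≤ 2 ^ k * Q.side}) ?_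
  obtain ⟨k, hk⟩ := pow_unbounded_of_one_lt (R.side / Q.side) (one_lt_two (α := ℝ))
  rw [div_lt_iff₀ hQ] at hk
  refine ⟨k + 1, k.succ_pos, hk.le.trans ?_⟩
  exact mul_le_mul_of_nonneg_right (pow_le_pow_right₀ one_le_two k.le_succ) hQ.le

lemma NQR_le {Q R : Cube d} {k : ℕ} (hk : 0 < k) (h : R.side ≤ 2 ^ k * Q.side) : NQR Q R ≤ k :=
  Nat.sInf_le ⟨hk, h⟩

lemma SQR_term_nonneg {Q : Cube d} (hQ : 0 < Q.side) (k : ℕ) :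
    0 ≤ (μ (Q.dilate (2 ^ k)).set).toReal / (2 ^ k * Q.side) ^ n := by
  positivity

lemma SQR_term_le {C₀ : ℝ} (hC₀ : 0 < C₀)
    (hgrowth : ∀ Q : Cube d, IsCube μ Q → μ Q.set ≤ ENNReal.ofReal (C₀ * Q.side ^ n))
    {Q : Cube d} (hQ : IsCube μ Q) (k : ℕ) :
    (μ (Q.dilate (2 ^ k)).set).toReal / (2 ^ k * Q.side) ^ n ≤ C₀ := by
  have hside := hQ.1
  rw [div_le_iff₀ (by positivity)]
  exact ENNReal.toReal_le_of_le_ofReal (by positivity) (hgrowth _ (hQ.dilate (by positivity)))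

lemma one_le_SQR {Q : Cube d} (hQ : 0 < Q.side) (R : Cube d) : 1 ≤ SQR μ n Q R :=
  le_add_of_nonneg_right (Finset.sum_nonneg fun k _ => SQR_term_nonneg hQ k)

lemma SQR_le {C₀ : ℝ} (hC₀ : 0 < C₀)
    (hgrowth : ∀ Q : Cube d, IsCube μ Q → μ Q.set ≤ ENNReal.ofReal (C₀ * Q.side ^ n))
    {Q : Cube d} (hQ : IsCube μ Q) (R : Cube d) : SQR μ n Q R ≤ 1 + C₀ * NQR Q R := by
  refine add_le_add_right ((Finset.sum_le_sum fun k _ => SQR_term_le hC₀ hgrowth hQ k).trans ?_) 1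
  simp [mul_comm]

lemma SQR_le_add {C₀ : ℝ} (hC₀ : 0 < C₀)
    (hgrowth : ∀ Q : Cube d, IsCube μ Q → μ Q.set ≤ ENNReal.ofReal (C₀ * Q.side ^ n))
    {Q R R' : Cube d} (hQ : IsCube μ Q) {m : ℕ} (hm : R.side ≤ 2 ^ m * R'.side) :
    SQR μ n Q R ≤ SQR μ n Q R' + C₀ * m := by
  obtain ⟨hN0, hN⟩ := NQR_mem hQ.1 R'
  have hle : NQR Q R ≤ NQR Q R' + m := by
    refine NQR_le (by omega) (hm.trans ?_)
    rw [pow_add, mul_comm (2 ^ NQR Q R'), mul_assoc]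
    exact mul_le_mul_of_nonneg_left hN (by positivity)
  have hsum : ∀ N m : ℕ,
      ∑ k ∈ Finset.Icc 1 (N + m), (μ (Q.dilate (2 ^ k)).set).toReal / (2 ^ k * Q.side) ^ n ≤
      ∑ k ∈ Finset.Icc 1 N, (μ (Q.dilate (2 ^ k)).set).toReal / (2 ^ k * Q.side) ^ n
        + C₀ * m := by
    intro N m
    induction m with
    | zero => simp
    | succ m ih =>
      rw [← add_assoc, Finset.sum_Icc_succ_top (by omega)]
      have := SQR_term_le hC₀ hgrowth hQ (N + m + 1)
      push_cast
      linarith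
  have hsub := Finset.sum_le_sum_of_subset_of_nonneg (Finset.Icc_subset_Icc_right (a := 1) hle)
    fun k _ _ => SQR_term_nonneg (μ := μ) (n := n) hQ.1 k
  have := hsum (NQR Q R') m
  rw [SQR, SQR]
  linarith

lemma IsCube.tilde {Q : Cube d} (hQ : IsCube μ Q) (ρ β : ℝ) : IsCube μ (tilde μ ρ β Q) :=
  hQ.dilate (by positivity)

lemma subset_tilde {Q : Cube d} (hQ : 0 ≤ Q.side) (ρ β : ℝ) :
    Q.set ⊆ (tilde μ ρ β Q).set :=
  Cube.subset_dilate hQ (one_le_pow₀ one_le_two)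

lemma side_le_tilde {Q : Cube d} (hQ : 0 ≤ Q.side) (ρ β : ℝ) :
    Q.side ≤ (tilde μ ρ β Q).side :=
  le_mul_of_one_le_left hQ (one_le_pow₀ one_le_two)

lemma tilde_of_isDoubling_dilate {ρ β : ℝ} {Q : Cube d} (hQ : 0 ≤ Q.side) {k : ℕ}
    (h : IsDoubling μ ρ β (Q.dilate (2 ^ k))) :
    IsDoubling μ ρ β (tilde μ ρ β Q) ∧ (tilde μ ρ β Q).side ≤ 2 ^ k * Q.side :=
  ⟨Nat.sInf_mem (s := {N : ℕ | IsDoubling μ ρ β (Q.dilate (2 ^ N))}) ⟨k, h⟩,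
    mul_le_mul_of_nonneg_right (pow_le_pow_right₀ one_le_two (Nat.sInf_le h)) hQ⟩

lemma isDoubling_tilde_or_eq (μ : Measure (Euc d)) (ρ β : ℝ) (Q : Cube d) :
    IsDoubling μ ρ β (tilde μ ρ β Q) ∨ tilde μ ρ β Q = Q := by
  rcases {N : ℕ | IsDoubling μ ρ β (Q.dilate (2 ^ N))}.eq_empty_or_nonempty with h | h
  · right; rw [tilde, h]; simp [Cube.dilate_one]
  · exact Or.inl (Nat.sInf_mem h)

lemma tilde_dilate (μ : Measure (Euc d)) {ρ β : ℝ} {Q : Cube d} {k : ℕ}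
    (hk : k ≤ sInf {N : ℕ | IsDoubling μ ρ β (Q.dilate (2 ^ N))}) :
    tilde μ ρ β (Q.dilate (2 ^ k)) = tilde μ ρ β Q := by
  have key := Nat.sInf_add (p := fun N => IsDoubling μ ρ β (Q.dilate (2 ^ N))) hk
  simp only [tilde, Cube.dilate_dilate, ← pow_add]
  rw [key]

/-- Below any doubling cube there are concentric cubes of any scale whose doubling enlargement
is not larger than the given cube. -/
lemma exists_side_tilde_le {ρ β : ℝ} {x : Euc d} {a s : ℝ} (ha : 0 < a) (hs : 0 < s)
    (hsa : s ≤ a) (h : IsDoubling μ ρ β ⟨x, a⟩) :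
    ∃ t : ℝ, s / 2 ≤ t ∧ t ≤ s ∧ IsDoubling μ ρ β (tilde μ ρ β ⟨x, t⟩) ∧
      (tilde μ ρ β ⟨x, t⟩).side ≤ a := by
  obtain ⟨k, hk1, hk2⟩ := exists_nat_pow_near ((one_le_div hs).2 hsa) (one_lt_two (α := ℝ))
  rw [le_div_iff₀ hs] at hk1
  rw [div_lt_iff₀ hs, pow_succ'] at hk2
  have hp : (0 : ℝ) < 2 ^ (k + 1) := by positivity
  have hp' : (2 : ℝ) ^ (k + 1) = 2 * 2 ^ k := pow_succ' _ _
  have ht : (0 : ℝ) < a / 2 ^ (k + 1) := by positivity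
  have heq : (2 : ℝ) ^ (k + 1) * (a / 2 ^ (k + 1)) = a := mul_div_cancel₀ _ hp.ne'
  have hd : IsDoubling μ ρ β ((Cube.mk x (a / 2 ^ (k + 1))).dilate (2 ^ (k + 1))) := by
    rw [Cube.dilate, heq]; exact h
  obtain ⟨h1, h2⟩ := tilde_of_isDoubling_dilate (Q := ⟨x, a / 2 ^ (k + 1)⟩) ht.le hd
  refine ⟨a / 2 ^ (k + 1), ?_, ?_, h1, h2.trans heq.le⟩
  · rw [le_div_iff₀ hp, hp']; linarith
  · rw [div_le_iff₀ hp, hp']; linarith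

lemma setIntegral_abs_le_closedBall {f : Euc d → ℝ} (hf : LocallyIntegrable f μ) {Q : Cube d}
    (hQ : 0 ≤ Q.side) {r : ℝ} (hr : ‖Q.center‖ + d * Q.side ≤ r) :
    ∫ y in Q.set, |f y| ∂μ ≤ ∫ y in closedBall 0 r, |f y| ∂μ := by
  refine setIntegral_mono_set (hf.integrableOn_isCompact (isCompact_closedBall _ _)).abs
    (Eventually.of_forall fun y => abs_nonneg _) (LE.le.eventuallyLE fun x hx => ?_)
  simpa using (Cube.norm_le_of_mem hQ hx).trans hr

/-- An integral over a cube is controlled by integrals over small cubes centered in the support. -/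
lemma setIntegral_abs_le_of_cover {g : Euc d → ℝ} (hg : LocallyIntegrable g μ) {Q : Cube d}
    (hQ : 0 < Q.side) {m : ℕ} (hm : 0 < m) {B : ℝ}
    (hB : ∀ x ∈ Q.set, x ∈ μ.support →
      ∫ y in (Cube.mk x (2 * (Q.side / m))).set, |g y| ∂μ ≤ B) (hB0 : 0 ≤ B) :
    ∫ y in Q.set, |g y| ∂μ ≤ ((m : ℝ) + 1) ^ d * B := by
  have hm' : (0 : ℝ) < m := by exact_mod_cast hm
  set h : ℝ := Q.side / m with hh
  have hh0 : 0 < h := div_pos hQ hm'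
  let F : Euc d → Fin d → ℕ := fun y i => ⌊(y i - Q.center i + Q.side / 2) / h⌋₊
  have hnn : ∀ y ∈ Q.set, ∀ i, 0 ≤ (y i - Q.center i + Q.side / 2) / h := fun y hy i =>
    div_nonneg (by linarith [(abs_le.1 (hy i)).1]) hh0.le
  let cell : (Fin d → Fin (m + 1)) → Set (Euc d) := fun j => {y ∈ Q.set | ∀ i, F y i = j i}
  have hcover : Q.set ⊆ ⋃ j, cell j := fun y hy => by
    refine mem_iUnion.2 ⟨fun i => ⟨F y i, ?_⟩, hy, fun i => rfl⟩
    refine Nat.lt_succ_of_le (Nat.floor_le_of_le ?_)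
    rw [div_le_iff₀ hh0, hh, mul_div_cancel₀ _ hm'.ne']
    linarith [(abs_le.1 (hy i)).2]
  have hnear : ∀ j, ∀ x ∈ cell j, cell j ⊆ (Cube.mk x (2 * h)).set := by
    intro j x hx y hy i
    change |y i - x i| ≤ 2 * h / 2
    have e : F y i = F x i := (hy.2 i).trans (hx.2 i).symm
    have hy1 := Nat.floor_le (hnn y hy.1 i)
    have hy2 := Nat.lt_floor_add_one ((y i - Q.center i + Q.side / 2) / h)
    have hx1 := Nat.floor_le (hnn x hx.1 i)
    have hx2 := Nat.lt_floor_add_one ((x i - Q.center i + Q.side / 2) / h)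
    change ((F y i : ℕ) : ℝ) ≤ _ at hy1
    change _ < ((F y i : ℕ) : ℝ) + 1 at hy2
    change ((F x i : ℕ) : ℝ) ≤ _ at hx1
    change _ < ((F x i : ℕ) : ℝ) + 1 at hx2
    rw [e, le_div_iff₀ hh0] at hy1
    rw [e, div_lt_iff₀ hh0] at hy2
    rw [le_div_iff₀ hh0] at hx1
    rw [div_lt_iff₀ hh0] at hx2
    rw [abs_le]
    constructor <;> linarith
  have hofReal : ∀ P : Cube d, 0 ≤ P.side →
      ENNReal.ofReal (∫ y in P.set, |g y| ∂μ) = ∫⁻ y in P.set, ‖g y‖ₑ ∂μ := fun P hP =>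
    ofReal_integral_norm_eq_lintegral_enorm (integrableOn_cube hg hP)
  have hcell : ∀ j, ∫⁻ y in cell j, ‖g y‖ₑ ∂μ ≤ ENNReal.ofReal B := by
    intro j
    by_cases hne : (cell j ∩ μ.support).Nonempty
    · obtain ⟨x, hx, hxs⟩ := hne
      refine (lintegral_mono_set (hnear j x hx)).trans ?_
      rw [← hofReal ⟨x, 2 * h⟩ (by positivity)]
      exact ENNReal.ofReal_le_ofReal (hB x hx.1 hxs)
    · have h0 : μ (cell j) = 0 := measure_mono_null
        (fun y hy hys => hne ⟨y, hy, hys⟩ : cell j ⊆ μ.supportᶜ) Measure.measure_compl_support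
      rw [setLIntegral_measure_zero _ _ h0]
      exact zero_le
  have htot : ENNReal.ofReal (∫ y in Q.set, |g y| ∂μ) ≤
      ENNReal.ofReal (((m : ℝ) + 1) ^ d * B) := by
    rw [hofReal Q hQ.le]
    refine (lintegral_mono_set hcover).trans ((lintegral_iUnion_le _ _).trans ?_)
    rw [tsum_fintype]
    refine (Finset.sum_le_sum fun j _ => hcell j).trans (le_of_eq ?_)
    rw [Finset.sum_const, ENNReal.ofReal_mul (by positivity), Finset.card_univ, nsmul_eq_mul,
      ENNReal.ofReal_pow (by positivity)]
    congr 1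
    rw [Fintype.card_fun, Fintype.card_fin, Fintype.card_fin]
    push_cast
    rw [ENNReal.ofReal_add (by positivity) (by positivity)]
    simp
  exact (ENNReal.ofReal_le_ofReal_iff (by positivity)).1 htot

variable [IsLocallyFiniteMeasure μ]

lemma cube_measure_ne_top (Q : Cube d) : μ Q.set ≠ ∞ := by
  rcases le_or_gt 0 Q.side with h | h
  · exact (Cube.isCompact_set h).measure_lt_top.ne
  · refine ((measure_mono (t := (Cube.mk Q.center 0).set) ?_).trans_lt
      (Cube.isCompact_set le_rfl).measure_lt_top).ne
    exact Cube.set_mono (s := Q.side) h.le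

lemma measureReal_cube_mono {P Q : Cube d} (h : P.set ⊆ Q.set) :
    μ.real P.set ≤ μ.real Q.set :=
  measureReal_mono h (cube_measure_ne_top Q)

lemma measureReal_le_dilate {Q : Cube d} (hQ : 0 ≤ Q.side) {α : ℝ} (hα : 1 ≤ α) :
    μ.real Q.set ≤ μ.real (Q.dilate α).set :=
  measureReal_cube_mono (Cube.subset_dilate hQ hα)

lemma IsCube.measureReal_pos {Q : Cube d} (hQ : IsCube μ Q) : 0 < μ.real Q.set :=
  ENNReal.toReal_pos ((hQ.2 _ (half_pos hQ.1)).trans_le (measure_mono Q.ball_subset_set)).ne'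
    (cube_measure_ne_top Q)

lemma isDoubling_iff_real {α β : ℝ} (hβ : 0 ≤ β) {Q : Cube d} :
    IsDoubling μ α β Q ↔ μ.real (Q.dilate α).set ≤ β * μ.real Q.set := by
  rw [IsDoubling, ← ENNReal.toReal_le_toReal (cube_measure_ne_top _)
    (ENNReal.mul_ne_top ENNReal.ofReal_ne_top (cube_measure_ne_top _)), ENNReal.toReal_mul,
    ENNReal.toReal_ofReal hβ]
  rfl

/-- Balls of a fixed radius centered at a bounded part of the support have mass bounded below. -/
lemma exists_pos_le_measureReal_ball (μ : Measure (Euc d)) [IsLocallyFiniteMeasure μ]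
    (r : ℝ) {δ : ℝ} (hδ : 0 < δ) :
    ∃ c : ℝ, 0 < c ∧ ∀ x ∈ μ.support, ‖x‖ ≤ r → c ≤ μ.real (ball x δ) := by
  have htb : TotallyBounded (μ.support ∩ closedBall 0 r) :=
    (isCompact_closedBall (0 : Euc d) r).totallyBounded.subset inter_subset_right
  obtain ⟨t, hts, htf, hcov⟩ := htb.exists_subset (Metric.dist_mem_uniformity (half_pos hδ))
  have hpos : ∀ y ∈ t, 0 < μ.real (ball y (δ / 2)) := fun y hy =>
    ENNReal.toReal_pos (mem_support_iff_ball.1 (hts hy).1 _ (half_pos hδ)).ne'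
      measure_ball_lt_top.ne
  obtain ⟨c, hc, hct⟩ : ∃ c : ℝ, 0 < c ∧ ∀ y ∈ t, c ≤ μ.real (ball y (δ / 2)) := by
    rcases t.eq_empty_or_nonempty with rfl | hne
    · exact ⟨1, one_pos, by simp⟩
    · obtain ⟨y, hy, hmin⟩ := exists_min_image t (fun y => μ.real (ball y (δ / 2))) htf hne
      exact ⟨_, hpos y hy, hmin⟩
  refine ⟨c, hc, fun x hx hxr => ?_⟩
  obtain ⟨y, hy, hxy⟩ := mem_iUnion₂.1 (hcov ⟨hx, by simpa using hxr⟩)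
  refine (hct y hy).trans (measureReal_mono (ball_subset_ball' ?_) measure_ball_lt_top.ne)
  have hxy' : dist x y < δ / 2 := hxy
  rw [dist_comm] at hxy'
  linarith

lemma exists_pos_le_measureReal_cube (μ : Measure (Euc d)) [IsLocallyFiniteMeasure μ]
    (r : ℝ) {δ : ℝ} (hδ : 0 < δ) :
    ∃ c : ℝ, 0 < c ∧ ∀ Q : Cube d, IsCube μ Q → ‖Q.center‖ ≤ r → δ ≤ Q.side →
      c ≤ μ.real Q.set := by
  obtain ⟨c, hc, h⟩ := exists_pos_le_measureReal_ball μ r (half_pos hδ)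
  refine ⟨c, hc, fun Q hQ hr hs => (h _ hQ.center_mem_support hr).trans
    (measureReal_mono ((ball_subset_ball ?_).trans Q.ball_subset_set) (cube_measure_ne_top Q))⟩
  linarith

/-- Above any scale there are doubling cubes of uniformly bounded size, uniformly over centers in a
bounded part of the support. -/
lemma exists_doubling_cube {C₀ ρ β : ℝ}
    (hgrowth : ∀ Q : Cube d, IsCube μ Q → μ Q.set ≤ ENNReal.ofReal (C₀ * Q.side ^ n))
    (hC₀ : 0 < C₀) (hρ : 1 < ρ) (hβ : ρ ^ n < β) (r : ℝ) {A : ℝ} (hA : 0 < A) :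
    ∃ A' : ℝ, A ≤ A' ∧ ∀ x ∈ μ.support, ‖x‖ ≤ r →
      ∃ a : ℝ, A ≤ a ∧ a ≤ A' ∧ IsDoubling μ ρ β ⟨x, a⟩ := by
  obtain ⟨c, hc, hcQ⟩ := exists_pos_le_measureReal_cube μ r hA
  have hρ0 : 0 < ρ := by linarith
  have hρn : 0 < ρ ^ n := by positivity
  have hβ0 : 0 < β := hρn.trans hβ
  obtain ⟨m, hm⟩ := pow_unbounded_of_one_lt (C₀ * A ^ n / c) ((one_lt_div hρn).2 hβ)
  refine ⟨ρ ^ m * A, le_mul_of_one_le_left hA.le (one_le_pow₀ hρ.le), fun x hx hxr => ?_⟩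
  by_contra! hcon
  have hgrow : ∀ k ≤ m, β ^ k * c ≤ μ.real (Cube.mk x (ρ ^ k * A)).set := by
    intro k
    induction k with
    | zero =>
      intro _
      simpa using hcQ ⟨x, A⟩ (isCube_mk hA hx) hxr le_rfl
    | succ k ih =>
      intro hk
      have hnd := hcon (ρ ^ k * A) (le_mul_of_one_le_left hA.le (one_le_pow₀ hρ.le))
        (mul_le_mul_of_nonneg_right (pow_le_pow_right₀ hρ.le (by omega)) hA.le)
      rw [isDoubling_iff_real hβ0.le, not_le] at hnd
      have heq : (Cube.mk x (ρ ^ k * A)).dilate ρ = Cube.mk x (ρ ^ (k + 1) * A) := by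
        simp [Cube.dilate, pow_succ]; ring
      rw [heq] at hnd
      refine le_trans ?_ hnd.le
      rw [pow_succ', mul_assoc]
      exact mul_le_mul_of_nonneg_left (ih (by omega)) hβ0.le
  have hup := ENNReal.toReal_le_of_le_ofReal (by positivity)
    (hgrowth ⟨x, ρ ^ m * A⟩ (isCube_mk (by positivity) hx))
  have h := (hgrow m le_rfl).trans hup
  rw [div_lt_iff₀ hc, div_pow, div_mul_eq_mul_div, lt_div_iff₀ (by positivity)] at hm
  have : C₀ * (ρ ^ m * A) ^ n = C₀ * A ^ n * (ρ ^ n) ^ m := by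
    rw [mul_pow, ← pow_mul, ← pow_mul, mul_comm m n]; ring
  change _ ≤ C₀ * (ρ ^ m * A) ^ n at h
  linarith

lemma measureReal_mul_abs_cubeAvg_sub_le {g : Euc d → ℝ} {Q : Cube d} (hQ : IsCube μ Q)
    (hg : IntegrableOn g Q.set μ) (a : ℝ) :
    μ.real Q.set * |cubeAvg μ Q g - a| ≤ ∫ y in Q.set, |g y - a| ∂μ := by
  have hpos := hQ.measureReal_pos
  have hc : IntegrableOn (fun _ => a) Q.set μ := integrableOn_const (cube_measure_ne_top Q)
  have e : μ.real Q.set * (cubeAvg μ Q g - a) = ∫ y in Q.set, (g y - a) ∂μ := by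
    rw [integral_sub hg hc, setIntegral_const, smul_eq_mul, cubeAvg, mul_sub]
    change μ.real Q.set * ((μ.real Q.set)⁻¹ * _) - _ = _
    rw [mul_inv_cancel_left₀ hpos.ne']
  rw [← abs_of_pos hpos, ← abs_mul, e]
  exact abs_integral_le_integral_abs

lemma measureReal_mul_abs_cubeAvg_le {g : Euc d → ℝ} {Q : Cube d} (hQ : IsCube μ Q)
    (hg : IntegrableOn g Q.set μ) :
    μ.real Q.set * |cubeAvg μ Q g| ≤ ∫ y in Q.set, |g y| ∂μ := by
  simpa using measureReal_mul_abs_cubeAvg_sub_le hQ hg 0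

lemma setIntegral_abs_le_add {g : Euc d → ℝ} {Q : Cube d} (hg : IntegrableOn g Q.set μ) (a : ℝ) :
    ∫ y in Q.set, |g y| ∂μ ≤ ∫ y in Q.set, |g y - a| ∂μ + μ.real Q.set * |a| := by
  have hc : ∀ b : ℝ, IntegrableOn (fun _ => b) Q.set μ := fun b =>
    integrableOn_const (cube_measure_ne_top Q)
  have hsub : IntegrableOn (fun y => |g y - a|) Q.set μ := (hg.sub (hc a)).abs
  rw [← smul_eq_mul, ← setIntegral_const, ← integral_add hsub (hc _)]
  refine integral_mono hg.abs (hsub.add (hc _)) fun y => ?_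
  simpa using abs_add_le (g y - a) a

lemma measureReal_mul_abs_le_add {g : Euc d → ℝ} {Q : Cube d} (hg : IntegrableOn g Q.set μ)
    (a : ℝ) :
    μ.real Q.set * |a| ≤ ∫ y in Q.set, |g y - a| ∂μ + ∫ y in Q.set, |g y| ∂μ := by
  have hc : ∀ b : ℝ, IntegrableOn (fun _ => b) Q.set μ := fun b =>
    integrableOn_const (cube_measure_ne_top Q)
  have hsub : IntegrableOn (fun y => |g y - a|) Q.set μ := (hg.sub (hc a)).abs
  rw [← smul_eq_mul, ← setIntegral_const, ← integral_add hsub hg.abs]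
  refine integral_mono (hc _) (hsub.add hg.abs) fun y => ?_
  have := abs_sub_abs_le_abs_sub a (g y)
  rw [abs_sub_comm] at this
  change |a| ≤ |g y - a| + |g y|
  linarith

lemma IsDoubling.measureReal_le {α β : ℝ} (hβ : 0 ≤ β) {Q : Cube d} (h : IsDoubling μ α β Q) :
    μ.real (Q.dilate α).set ≤ β * μ.real Q.set :=
  (isDoubling_iff_real hβ).1 h

variable {C₀ η ρ β C : ℝ} {f : Euc d → ℝ}

/-- The average over a doubling cube is compared with the one over a concentric doubling cube of
size about one. -/
lemma exists_abs_cubeAvg_le_SQR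
    (hgrowth : ∀ Q : Cube d, IsCube μ Q → μ Q.set ≤ ENNReal.ofReal (C₀ * Q.side ^ n))
    (hC₀ : 0 < C₀) (hρ : 1 < ρ) (hβ : ρ ^ n < β) (hf : LocallyIntegrable f μ)
    (h : RBMOBound μ n η ρ β f C) (r : ℝ) {A : ℝ} (hA : 0 < A) :
    ∃ A' K : ℝ, A ≤ A' ∧ 0 ≤ K ∧ ∀ Q : Cube d, IsCube μ Q → ‖Q.center‖ ≤ r → Q.side ≤ A →
      IsDoubling μ ρ β Q →
      ∃ R : Cube d, R.side ≤ A' ∧ |cubeAvg μ Q f| ≤ K + C * SQR μ n Q R := by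
  obtain ⟨A', hAA', hA'⟩ := exists_doubling_cube hgrowth hC₀ hρ hβ r hA
  obtain ⟨c, hc, hcQ⟩ := exists_pos_le_measureReal_cube μ r hA
  set I := ∫ y in closedBall 0 (r + d * A'), |f y| ∂μ
  have hI : 0 ≤ I := integral_nonneg fun y => abs_nonneg _
  refine ⟨A', I / c, hAA', by positivity, fun Q hQ hr hs hd => ?_⟩
  obtain ⟨a, ha1, ha2, had⟩ := hA' Q.center hQ.center_mem_support hr
  have ha0 : 0 < a := hA.trans_le ha1
  have hR : IsCube μ ⟨Q.center, a⟩ := isCube_mk ha0 hQ.center_mem_support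
  refine ⟨⟨Q.center, a⟩, ha2, ?_⟩
  have h1 := h.2 Q ⟨Q.center, a⟩ hQ hR
    (Cube.set_mono (x := Q.center) (s := Q.side) (hs.trans ha1)) hd had
  have h2 := measureReal_mul_abs_cubeAvg_le hR (integrableOn_cube hf ha0.le)
  have h3 : ∫ y in (Cube.mk Q.center a).set, |f y| ∂μ ≤ I :=
    setIntegral_abs_le_closedBall hf ha0.le
      (add_le_add hr (mul_le_mul_of_nonneg_left ha2 (by positivity)))
  have h4 := mul_le_mul_of_nonneg_right (hcQ _ hR hr ha1) (abs_nonneg (cubeAvg μ ⟨Q.center, a⟩ f))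
  have h5 : |cubeAvg μ ⟨Q.center, a⟩ f| ≤ I / c := by
    rw [le_div_iff₀ hc]; linarith
  have := abs_sub_abs_le_abs_sub (cubeAvg μ Q f) (cubeAvg μ ⟨Q.center, a⟩ f)
  linarith

lemma exists_abs_cubeAvg_le_div_side
    (hgrowth : ∀ Q : Cube d, IsCube μ Q → μ Q.set ≤ ENNReal.ofReal (C₀ * Q.side ^ n))
    (hC₀ : 0 < C₀) (hρ : 1 < ρ) (hβ : ρ ^ n < β) (hf : LocallyIntegrable f μ) (hC : 0 ≤ C)
    (h : RBMOBound μ n η ρ β f C) (r : ℝ) {A : ℝ} (hA : 0 < A) :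
    ∃ K : ℝ, 0 ≤ K ∧ ∀ Q : Cube d, IsCube μ Q → ‖Q.center‖ ≤ r → Q.side ≤ A →
      IsDoubling μ ρ β Q → |cubeAvg μ Q f| ≤ K / Q.side := by
  obtain ⟨A', K, hAA', hK, hKQ⟩ := exists_abs_cubeAvg_le_SQR hgrowth hC₀ hρ hβ hf h r hA
  have hA' : 0 < A' := hA.trans_le hAA'
  refine ⟨(K + C * (1 + C₀ * 2)) * A + C * C₀ * A', by positivity, fun Q hQ hr hs hd => ?_⟩
  obtain ⟨R, hRA, hR⟩ := hKQ Q hQ hr hs hd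
  have hside := hQ.1
  have hN : (NQR Q R : ℝ) ≤ A' / Q.side + 2 := by
    have hle : NQR Q R ≤ ⌈A' / Q.side⌉₊ + 1 := by
      refine NQR_le (Nat.succ_pos _) ?_
      rw [← div_le_iff₀ hside]
      calc R.side / Q.side ≤ A' / Q.side := div_le_div_of_nonneg_right hRA hside.le
        _ ≤ (⌈A' / Q.side⌉₊ : ℝ) := Nat.le_ceil _
        _ ≤ ((⌈A' / Q.side⌉₊ + 1 : ℕ) : ℝ) := by push_cast; linarith
        _ ≤ ((2 ^ (⌈A' / Q.side⌉₊ + 1) : ℕ) : ℝ) := by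
          exact_mod_cast Nat.lt_two_pow_self.le
        _ = 2 ^ (⌈A' / Q.side⌉₊ + 1) := by push_cast; rfl
    have hle' : (NQR Q R : ℝ) ≤ (⌈A' / Q.side⌉₊ : ℝ) + 1 := by exact_mod_cast hle
    have := Nat.ceil_lt_add_one (div_pos hA' hside).le
    linarith
  have hS := SQR_le hC₀ hgrowth hQ R
  have h1 : SQR μ n Q R ≤ 1 + C₀ * (A' / Q.side + 2) :=
    hS.trans (by gcongr)
  have h2 := mul_le_mul_of_nonneg_left h1 hC
  have h3 : K + C * (1 + C₀ * 2) ≤ (K + C * (1 + C₀ * 2)) * A / Q.side := by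
    rw [le_div_iff₀ hside]
    gcongr
  rw [add_div]
  have h4 : C * (1 + C₀ * (A' / Q.side + 2)) =
      C * (1 + C₀ * 2) + C * C₀ * A' / Q.side := by ring
  linarith

lemma exists_abs_cubeAvg_le_mul_SQR
    (hgrowth : ∀ Q : Cube d, IsCube μ Q → μ Q.set ≤ ENNReal.ofReal (C₀ * Q.side ^ n))
    (hC₀ : 0 < C₀) (hρ : 1 < ρ) (hβ : ρ ^ n < β) (hf : LocallyIntegrable f μ) (hC : 0 ≤ C)
    (h : RBMOBound μ n η ρ β f C) (r : ℝ) :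
    ∃ K : ℝ, 0 ≤ K ∧ ∀ Q R : Cube d, IsCube μ Q → ‖Q.center‖ ≤ r → Q.side ≤ 1 →
      IsDoubling μ ρ β Q → 1 ≤ R.side → |cubeAvg μ Q f| ≤ K * SQR μ n Q R := by
  obtain ⟨A', K, hAA', hK, hKQ⟩ := exists_abs_cubeAvg_le_SQR hgrowth hC₀ hρ hβ hf h r one_pos
  obtain ⟨m, hm⟩ := pow_unbounded_of_one_lt A' (one_lt_two (α := ℝ))
  refine ⟨K + C * C₀ * m + C, by positivity, fun Q R hQ hr hs hd hR => ?_⟩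
  obtain ⟨R', hRA, hR'⟩ := hKQ Q hQ hr hs hd
  have hside : R'.side ≤ 2 ^ m * R.side :=
    (hRA.trans hm.le).trans (le_mul_of_one_le_right (by positivity) hR)
  have h1 := mul_le_mul_of_nonneg_left (SQR_le_add hC₀ hgrowth hQ hside) hC
  have h2 := mul_le_mul_of_nonneg_left (one_le_SQR (μ := μ) (n := n) hQ.1 R)
    (by positivity : 0 ≤ K + C * C₀ * m)
  linarith

/-- The crucial estimate: `ℓ(Q) ∫_Q |f|` is controlled by the mass of any fixed dilate of `Q`. -/
lemma exists_setIntegral_abs_le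
    (hgrowth : ∀ Q : Cube d, IsCube μ Q → μ Q.set ≤ ENNReal.ofReal (C₀ * Q.side ^ n))
    (hC₀ : 0 < C₀) (hη : 1 < η) (hρ : 1 < ρ) (hβ : ρ ^ n < β) (hf : LocallyIntegrable f μ)
    (hC : 0 ≤ C) (h : RBMOBound μ n η ρ β f C) (r : ℝ) {θ : ℝ} (hθ : 1 < θ) :
    ∃ K : ℝ, 0 ≤ K ∧ ∀ Q : Cube d, IsCube μ Q → ‖Q.center‖ ≤ r → Q.side ≤ 1 →
      ∫ y in Q.set, |f y| ∂μ ≤ K * μ.real (Q.dilate θ).set / Q.side := by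
  obtain ⟨A, hA1, hA⟩ := exists_doubling_cube hgrowth hC₀ hρ hβ (r + d) one_pos
  obtain ⟨K, hK, hKQ⟩ := exists_abs_cubeAvg_le_div_side hgrowth hC₀ hρ hβ hf hC h (r + d)
    (one_pos.trans_le hA1)
  obtain ⟨m, hm⟩ := exists_nat_ge (max 4 (4 * η / (θ - 1)))
  have hm4 : (4 : ℝ) ≤ m := (le_max_left _ _).trans hm
  have hmθ : 4 * η ≤ m * (θ - 1) := (div_le_iff₀ (by linarith)).1 ((le_max_right _ _).trans hm)
  have hm0 : (0 : ℝ) < m := by linarith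
  refine ⟨((m : ℝ) + 1) ^ d * (C + K * m / 2), by positivity, fun Q hQ hr hs => ?_⟩
  have hside := hQ.1
  have hBdef : ((m : ℝ) + 1) ^ d * (C + K * m / 2) * μ.real (Q.dilate θ).set / Q.side =
      ((m : ℝ) + 1) ^ d * ((C + K * m / 2) * μ.real (Q.dilate θ).set / Q.side) := by ring
  rw [hBdef]
  refine setIntegral_abs_le_of_cover hf hside (by exact_mod_cast hm0) (fun x hx hxs => ?_)
    (by positivity)
  have hxr : ‖x‖ ≤ r + d := by
    have h1 := Cube.norm_le_of_mem hside.le hx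
    have h2 : (d : ℝ) * Q.side ≤ d * 1 := by gcongr
    linarith
  obtain ⟨a, ha1, haA, had⟩ := hA x hxs hxr
  have hs1 : 4 * (Q.side / m) ≤ 1 := by
    rw [mul_div_assoc', div_le_one hm0]; linarith
  have hsm : 0 < Q.side / m := by positivity
  obtain ⟨t, ht1, ht2, htd, htA⟩ := exists_side_tilde_le (by linarith) (by positivity)
    (hs1.trans ha1) had
  have ht0 : 0 < t := by linarith
  have hP : IsCube μ ⟨x, t⟩ := isCube_mk ht0 hxs
  set P : Cube d := ⟨x, t⟩ with hPdef
  have hsub : (P.dilate η).set ⊆ (Q.dilate θ).set := fun z hz i => by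
    have h1 : |z i - x i| ≤ η * t / 2 := hz i
    have h2 := hx i
    have h3 := abs_sub_le (z i) (x i) (Q.center i)
    have h4 : η * t ≤ (θ - 1) * Q.side := by
      calc η * t ≤ η * (4 * (Q.side / m)) := by gcongr
        _ = 4 * η * Q.side / m := by ring
        _ ≤ m * (θ - 1) * Q.side / m := by gcongr
        _ = (θ - 1) * Q.side := by field_simp
    change |z i - Q.center i| ≤ θ * Q.side / 2
    linarith
  have hμη := measureReal_cube_mono (μ := μ) hsub
  have hμP := (measureReal_le_dilate (μ := μ) (Q := P) ht0.le hη.le).trans hμη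
  have havg : |cubeAvg μ (tilde μ ρ β P) f| ≤ K * m / 2 / Q.side := by
    refine (hKQ _ (hP.tilde ρ β) hxr (htA.trans haA) htd).trans ?_
    have hge : 2 * (Q.side / m) ≤ (tilde μ ρ β P).side := by
      have : t ≤ _ := side_le_tilde (μ := μ) (Q := P) ht0.le ρ β
      linarith
    calc K / (tilde μ ρ β P).side ≤ K / (2 * (Q.side / m)) := by gcongr
      _ = K * m / 2 / Q.side := by field_simp
  have hint := integrableOn_cube (Q := P) hf ht0.le
  calc ∫ y in (Cube.mk x (2 * (Q.side / m))).set, |f y| ∂μ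
      ≤ ∫ y in P.set, |f y| ∂μ := by
        refine setIntegral_mono_set hint.abs (Eventually.of_forall fun y => abs_nonneg _)
          (LE.le.eventuallyLE (Cube.set_mono ?_))
        linarith
    _ ≤ ∫ y in P.set, |f y - cubeAvg μ (tilde μ ρ β P) f| ∂μ +
          μ.real P.set * |cubeAvg μ (tilde μ ρ β P) f| := setIntegral_abs_le_add hint _
    _ ≤ C * μ.real (Q.dilate θ).set + μ.real (Q.dilate θ).set * (K * m / 2 / Q.side) := by
        refine add_le_add ((h.1 P hP).trans (mul_le_mul_of_nonneg_left hμη hC)) ?_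
        gcongr
    _ ≤ C * μ.real (Q.dilate θ).set / Q.side +
          μ.real (Q.dilate θ).set * (K * m / 2 / Q.side) := by
        gcongr
        rw [le_div_iff₀ hside]
        exact mul_le_of_le_one_right (by positivity) hs
    _ = (C + K * m / 2) * μ.real (Q.dilate θ).set / Q.side := by ring

/-- If a small cube has a large doubling enlargement, the average over the latter is bounded. -/
lemma exists_abs_cubeAvg_tilde_le
    (hgrowth : ∀ Q : Cube d, IsCube μ Q → μ Q.set ≤ ENNReal.ofReal (C₀ * Q.side ^ n))
    (hC₀ : 0 < C₀) (hη : 1 < η) (hf : LocallyIntegrable f μ)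
    (hC : 0 ≤ C) (h : RBMOBound μ n η ρ β f C) (r : ℝ) :
    ∃ K : ℝ, 0 ≤ K ∧ ∀ Q : Cube d, IsCube μ Q → ‖Q.center‖ ≤ r → Q.side ≤ 1 →
      1 ≤ (tilde μ ρ β Q).side → |cubeAvg μ (tilde μ ρ β Q) f| ≤ K := by
  obtain ⟨c, hc, hcQ⟩ := exists_pos_le_measureReal_cube μ r (half_pos one_pos)
  set I := ∫ y in closedBall 0 (r + d), |f y| ∂μ
  have hI : 0 ≤ I := integral_nonneg fun y => abs_nonneg _
  refine ⟨(C * (C₀ * η ^ n) + I) / c, by positivity, fun Q hQ hr hs hT => ?_⟩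
  have hside := hQ.1
  have hη0 : 0 < η := by linarith
  obtain ⟨k, hk1, hk2⟩ := exists_nat_pow_near ((one_le_div hside).2 hs) (one_lt_two (α := ℝ))
  rw [le_div_iff₀ hside] at hk1
  rw [div_lt_iff₀ hside, pow_succ'] at hk2
  have hkN : k ≤ sInf {N : ℕ | IsDoubling μ ρ β (Q.dilate (2 ^ N))} := by
    have h1 : (2 : ℝ) ^ k * Q.side ≤
        2 ^ sInf {N : ℕ | IsDoubling μ ρ β (Q.dilate (2 ^ N))} * Q.side := hk1.trans hT
    exact (pow_le_pow_iff_right₀ one_lt_two).1 (le_of_mul_le_mul_right h1 hside)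
  have hP : IsCube μ (Q.dilate (2 ^ k)) := hQ.dilate (by positivity)
  have hPs : (Q.dilate (2 ^ k)).side ≤ 1 := hk1
  have hPs' : 1 / 2 ≤ (Q.dilate (2 ^ k)).side := by
    change 1 / 2 ≤ 2 ^ k * Q.side; linarith
  have hPr : ‖(Q.dilate (2 ^ k)).center‖ ≤ r := hr
  rw [← tilde_dilate μ hkN]
  set P := Q.dilate (2 ^ k)
  have h1 := h.1 P hP
  have h2 : μ.real (P.dilate η).set ≤ C₀ * η ^ n := by
    have hP0 := hP.1
    refine (ENNReal.toReal_le_of_le_ofReal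
      (mul_nonneg hC₀.le (pow_nonneg (mul_nonneg hη0.le hP0.le) n))
      (hgrowth _ (hP.dilate (α := η) (by linarith)))).trans ?_
    change C₀ * (η * P.side) ^ n ≤ _
    gcongr
    exact mul_le_of_le_one_right (by linarith) hPs
  have h3 := measureReal_mul_abs_le_add (integrableOn_cube hf hP.1.le)
    (cubeAvg μ (tilde μ ρ β P) f)
  have h4 : ∫ y in P.set, |f y| ∂μ ≤ I := setIntegral_abs_le_closedBall hf hP.1.le
    (add_le_add hPr (mul_le_of_le_one_right (by positivity) hPs))
  have h5 := mul_le_mul_of_nonneg_right (hcQ P hP hPr hPs')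
    (abs_nonneg (cubeAvg μ (tilde μ ρ β P) f))
  have h6 := mul_le_mul_of_nonneg_left h2 hC
  change _ ≤ C * μ.real (P.dilate η).set at h1
  rw [le_div_iff₀ hc]
  linarith

/-- Integrals of a compactly supported function over large cubes. -/
lemma exists_setIntegral_abs_le_of_one_le_side {g : Euc d → ℝ} (hg : Integrable g μ) {r : ℝ}
    (hr : ∀ x, r < ‖x‖ → g x = 0) {θ : ℝ} (hθ : 1 < θ) :
    ∃ K : ℝ, 0 ≤ K ∧ ∀ Q : Cube d, IsCube μ Q → 1 ≤ Q.side →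
      ∫ y in Q.set, |g y| ∂μ ≤ K * μ.real (Q.dilate θ).set := by
  obtain ⟨c, hc, hcx⟩ := exists_pos_le_measureReal_ball μ r
    (div_pos (sub_pos.2 hθ) zero_lt_two)
  have hI : 0 ≤ ∫ y, |g y| ∂μ := integral_nonneg fun y => abs_nonneg _
  refine ⟨(∫ y, |g y| ∂μ) / c, by positivity, fun Q hQ hs => ?_⟩
  by_cases hx : ∃ x ∈ Q.set, x ∈ μ.support ∧ ‖x‖ ≤ r
  · obtain ⟨x, hxQ, hxs, hxr⟩ := hx
    have h1 : c ≤ μ.real (Q.dilate θ).set :=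
      (hcx x hxs hxr).trans (measureReal_mono ((ball_subset_ball (by
        have : θ - 1 ≤ (θ - 1) * Q.side := le_mul_of_one_le_right (by linarith) hs
        linarith)).trans (Cube.ball_subset_dilate hxQ)) (cube_measure_ne_top _))
    refine (setIntegral_le_integral hg.abs (Eventually.of_forall fun y => abs_nonneg _)).trans ?_
    rw [div_mul_eq_mul_div, le_div_iff₀ hc]
    gcongr
  · have h0 : ∫ y in Q.set, |g y| ∂μ = 0 := by
      rw [← integral_zero (Euc d) ℝ (μ := μ.restrict Q.set)]
      refine setIntegral_congr_ae Q.measurableSet_set ?_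
      filter_upwards [Measure.support_mem_ae (μ := μ)] with y hy hyQ
      rw [hr y (not_le.1 fun hyr => hx ⟨y, hyQ, hy, hyr⟩), abs_zero]
    rw [h0]
    positivity

variable {φ : Euc d → ℝ} {M L r : ℝ}

/-- On a small cube, averaging the product costs only the oscillation of `φ`. -/
lemma exists_abs_cubeAvg_mul_sub_le
    (hgrowth : ∀ Q : Cube d, IsCube μ Q → μ Q.set ≤ ENNReal.ofReal (C₀ * Q.side ^ n))
    (hC₀ : 0 < C₀) (hη : 1 < η) (hρ : 1 < ρ) (hβ : ρ ^ n < β) (hf : LocallyIntegrable f μ)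
    (hC : 0 ≤ C) (h : RBMOBound μ n η ρ β f C)
    (hg : LocallyIntegrable (fun x => f x * φ x) μ) (hL0 : 0 ≤ L)
    (hL : ∀ x y, |φ x - φ y| ≤ L * ‖x - y‖) (r : ℝ) {θ : ℝ} (hθ : 1 < θ) :
    ∃ K : ℝ, 0 ≤ K ∧ ∀ Q : Cube d, IsCube μ Q → ‖Q.center‖ ≤ r → Q.side ≤ 1 → ∀ x ∈ Q.set,
      μ.real Q.set * |cubeAvg μ Q f * φ x - cubeAvg μ Q (fun y => f y * φ y)| ≤
        K * μ.real (Q.dilate θ).set := by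
  obtain ⟨K, hK, hKQ⟩ := exists_setIntegral_abs_le hgrowth hC₀ hη hρ hβ hf hC h r hθ
  refine ⟨L * d * K, by positivity, fun Q hQ hr hs x hx => ?_⟩
  have hside := hQ.1
  have hpos := hQ.measureReal_pos
  have hfi := integrableOn_cube hf hside.le
  have hgi := integrableOn_cube hg hside.le
  have e : μ.real Q.set * (cubeAvg μ Q f * φ x - cubeAvg μ Q (fun y => f y * φ y)) =
      ∫ y in Q.set, (f y * φ x - f y * φ y) ∂μ := by
    rw [integral_sub (hfi.mul_const _) hgi, integral_mul_const, cubeAvg, cubeAvg]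
    change μ.real Q.set * ((μ.real Q.set)⁻¹ * _ * _ - (μ.real Q.set)⁻¹ * _) = _
    field_simp
  rw [← abs_of_pos hpos, ← abs_mul, e]
  calc |∫ y in Q.set, (f y * φ x - f y * φ y) ∂μ|
      ≤ ∫ y in Q.set, |f y * φ x - f y * φ y| ∂μ := abs_integral_le_integral_abs
    _ ≤ ∫ y in Q.set, L * (d * Q.side) * |f y| ∂μ := by
        refine setIntegral_mono_on ((hfi.mul_const _).sub hgi).abs (hfi.abs.const_mul _)
          Q.measurableSet_set fun y hy => ?_
        rw [← mul_sub, abs_mul, mul_comm]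
        gcongr
        refine (hL x y).trans ?_
        gcongr
        exact Cube.norm_sub_le_of_mem hx hy
    _ = L * (d * Q.side) * ∫ y in Q.set, |f y| ∂μ := integral_const_mul _ _
    _ ≤ L * (d * Q.side) * (K * μ.real (Q.dilate θ).set / Q.side) := by
        gcongr
        exact hKQ Q hQ hr hs
    _ = L * d * K * μ.real (Q.dilate θ).set := by field_simp

lemma exists_oscillation_mul_le
    (hgrowth : ∀ Q : Cube d, IsCube μ Q → μ Q.set ≤ ENNReal.ofReal (C₀ * Q.side ^ n))
    (hC₀ : 0 < C₀) (hη : 1 < η) (hρ : 1 < ρ) (hβ : ρ ^ n < β) (hf : LocallyIntegrable f μ)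
    (hC : 0 ≤ C) (h : RBMOBound μ n η ρ β f C)
    (hg : Integrable (fun x => f x * φ x) μ) (hL0 : 0 ≤ L)
    (hL : ∀ x y, |φ x - φ y| ≤ L * ‖x - y‖) (hM : ∀ x, |φ x| ≤ M)
    (hr : ∀ x, r < ‖x‖ → φ x = 0) :
    ∃ K : ℝ, 0 ≤ K ∧ ∀ Q : Cube d, IsCube μ Q →
      ∫ x in Q.set, |f x * φ x - cubeAvg μ (tilde μ ρ β Q) (fun y => f y * φ y)| ∂μ
        ≤ K * μ.real (Q.dilate η).set := by
  have hβ0 : 0 < β := (by positivity : 0 < ρ ^ n).trans hβ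
  have hM0 : 0 ≤ M := (abs_nonneg _).trans (hM 0)
  have hgr : ∀ x, r < ‖x‖ → f x * φ x = 0 := fun x hx => by rw [hr x hx, mul_zero]
  obtain ⟨Kη, hKη, hη'⟩ := exists_abs_cubeAvg_mul_sub_le hgrowth hC₀ hη hρ hβ hf hC h
    hg.locallyIntegrable hL0 hL (r + d) hη
  obtain ⟨Kρ, hKρ, hρ'⟩ := exists_abs_cubeAvg_mul_sub_le hgrowth hC₀ hη hρ hβ hf hC h
    hg.locallyIntegrable hL0 hL (r + d) hρ
  obtain ⟨Fη, hFη, hFη'⟩ := exists_setIntegral_abs_le_of_one_le_side hg hgr hη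
  obtain ⟨Fρ, hFρ, hFρ'⟩ := exists_setIntegral_abs_le_of_one_le_side hg hgr hρ
  obtain ⟨G, hG, hG'⟩ := exists_abs_cubeAvg_tilde_le hgrowth hC₀ hη hf hC h (r + d)
  refine ⟨(M * C + Kη + Kρ * β) + (Fη + M * (C + G)) + (Fη + M * (C + G) + Fρ * β),
    by positivity, fun Q hQ => ?_⟩
  have hside := hQ.1
  set T := tilde μ ρ β Q with hTdef
  have hT : IsCube μ T := hQ.tilde ρ β
  have hQT : Q.set ⊆ T.set := subset_tilde hside.le ρ β
  have hsT : Q.side ≤ T.side := side_le_tilde hside.le ρ β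
  set m := μ.real (Q.dilate η).set with hm
  have hQm : μ.real Q.set ≤ m := measureReal_le_dilate hside.le hη.le
  have hm0 : 0 ≤ m := measureReal_nonneg
  have hfi := integrableOn_cube hf hside.le
  have hgi : IntegrableOn (fun x => f x * φ x) Q.set μ := hg.integrableOn
  have hc : ∀ b : ℝ, IntegrableOn (fun _ => b) Q.set μ := fun b =>
    integrableOn_const (cube_measure_ne_top Q)
  have hcenter : ∀ P : Cube d, 0 ≤ P.side → P.side ≤ 1 → (∃ x ∈ P.set, ‖x‖ ≤ r) →
      ‖P.center‖ ≤ r + d := fun P hP hP1 ⟨x, hx, hxr⟩ => by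
    have := Cube.norm_center_le_of_mem hP hx
    have : (d : ℝ) * P.side ≤ d := mul_le_of_le_one_right (by positivity) hP1
    linarith
  have hosc := h.1 Q hQ
  change _ ≤ C * m at hosc
  have hX : 0 ≤ M * C + Kη + Kρ * β := by positivity
  have hY : 0 ≤ Fη + M * (C + G) := by positivity
  have hZ : 0 ≤ Fρ * β := by positivity
  by_cases hz : ∃ x ∈ T.set, ‖x‖ ≤ r
  · rcases le_or_gt T.side 1 with hT1 | hT1
    · have hTr := hcenter T hT.1.le hT1 hz
      have hpt : ∀ x ∈ Q.set, μ.real Q.set *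
          |cubeAvg μ T f * φ x - cubeAvg μ T (fun y => f y * φ y)| ≤ (Kη + Kρ * β) * m := by
        intro x hx
        rcases isDoubling_tilde_or_eq μ ρ β Q with hd | he
        · have h1 := hρ' T hT hTr hT1 x (hQT hx)
          have h2 := mul_le_mul_of_nonneg_left (hd.measureReal_le hβ0.le) hKρ
          have h3 : |cubeAvg μ T f * φ x - cubeAvg μ T (fun y => f y * φ y)| ≤ Kρ * β := by
            refine le_of_mul_le_mul_left ?_ hT.measureReal_pos
            linarith
          calc _ ≤ m * (Kρ * β) := by gcongr
            _ ≤ (Kη + Kρ * β) * m := by nlinarith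
        · have hTQ : T = Q := he
          rw [hTQ] at hTr hT1 ⊢
          have h1 := hη' Q hQ hTr hT1 x hx
          have h2 : 0 ≤ Kρ * β * m := by positivity
          linarith
      set b := (Kη + Kρ * β) * m / μ.real Q.set with hb
      have hpos := hQ.measureReal_pos
      have hsub : IntegrableOn (fun x => M * |f x - cubeAvg μ T f|) Q.set μ :=
        (hfi.sub (hc _)).abs.const_mul M
      calc ∫ x in Q.set, |f x * φ x - cubeAvg μ T (fun y => f y * φ y)| ∂μ
          ≤ ∫ x in Q.set, (M * |f x - cubeAvg μ T f| + b) ∂μ := by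
            refine setIntegral_mono_on (hgi.sub (hc _)).abs (hsub.add (hc b))
              Q.measurableSet_set fun x hx => ?_
            have h1 : |cubeAvg μ T f * φ x - cubeAvg μ T (fun y => f y * φ y)| ≤ b := by
              rw [hb, le_div_iff₀ hpos, mul_comm]; exact hpt x hx
            have h2 : |(f x - cubeAvg μ T f) * φ x| ≤ M * |f x - cubeAvg μ T f| := by
              rw [abs_mul, mul_comm]; gcongr; exact hM x
            have h3 := abs_add_le ((f x - cubeAvg μ T f) * φ x)
              (cubeAvg μ T f * φ x - cubeAvg μ T (fun y => f y * φ y))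
            rw [sub_mul, sub_add_sub_cancel, ← sub_mul] at h3
            linarith
        _ = M * ∫ x in Q.set, |f x - cubeAvg μ T f| ∂μ + (Kη + Kρ * β) * m := by
            rw [integral_add hsub (hc b), integral_const_mul, setIntegral_const,
              smul_eq_mul, hb, mul_div_cancel₀ _ hpos.ne']
        _ ≤ M * (C * m) + (Kη + Kρ * β) * m := by gcongr
        _ ≤ _ := by nlinarith [mul_nonneg hY hm0, mul_nonneg hZ hm0]
    · have hfirst : ∫ x in Q.set, |f x * φ x| ∂μ ≤ (Fη + M * (C + G)) * m := by
        rcases le_or_gt 1 Q.side with hQ1 | hQ1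
        · have h1 := hFη' Q hQ hQ1
          have h2 : 0 ≤ M * (C + G) * m := by positivity
          linarith
        · by_cases hzQ : ∃ x ∈ Q.set, ‖x‖ ≤ r
          · have h1 := hG' Q hQ (hcenter Q hside.le hQ1.le hzQ) hQ1.le hT1.le
            have h2 := setIntegral_abs_le_add hfi (cubeAvg μ T f)
            calc ∫ x in Q.set, |f x * φ x| ∂μ ≤ ∫ x in Q.set, M * |f x| ∂μ := by
                  refine integral_mono hgi.abs (hfi.abs.const_mul M) fun x => ?_
                  change |f x * φ x| ≤ M * |f x|
                  rw [abs_mul, mul_comm]; gcongr; exact hM x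
              _ = M * ∫ x in Q.set, |f x| ∂μ := integral_const_mul _ _
              _ ≤ M * (C * m + m * G) := by
                  refine mul_le_mul_of_nonneg_left (h2.trans (add_le_add hosc ?_)) hM0
                  gcongr
              _ ≤ _ := by nlinarith [mul_nonneg hFη hm0]
          · rw [setIntegral_eq_zero_of_forall_eq_zero fun x hx => by
              rw [hgr x (not_le.1 fun hxr => hzQ ⟨x, hx, hxr⟩), abs_zero]]
            positivity
      have hsecond : μ.real Q.set * |cubeAvg μ T (fun y => f y * φ y)| ≤
          (Fη + M * (C + G) + Fρ * β) * m := by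
        rcases isDoubling_tilde_or_eq μ ρ β Q with hd | he
        · have h1 := hFρ' T hT hT1.le
          have h2 := mul_le_mul_of_nonneg_left (hd.measureReal_le hβ0.le) hFρ
          have h3 := measureReal_mul_abs_cubeAvg_le hT hg.integrableOn
          have h4 : |cubeAvg μ T (fun y => f y * φ y)| ≤ Fρ * β := by
            refine le_of_mul_le_mul_left ?_ hT.measureReal_pos
            linarith
          calc _ ≤ m * (Fρ * β) := by gcongr
            _ ≤ _ := by nlinarith [mul_nonneg hY hm0]
        · have hTQ : T = Q := he
          rw [hTQ]
          have h1 := measureReal_mul_abs_cubeAvg_le hQ hgi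
          nlinarith [mul_nonneg hZ hm0]
      have htri : ∫ x in Q.set, |f x * φ x - cubeAvg μ T (fun y => f y * φ y)| ∂μ ≤
          ∫ x in Q.set, |f x * φ x| ∂μ + μ.real Q.set * |cubeAvg μ T (fun y => f y * φ y)| := by
        rw [← smul_eq_mul, ← setIntegral_const, ← integral_add hgi.abs (hc _)]
        exact integral_mono (hgi.sub (hc _)).abs (hgi.abs.add (hc _)) fun x => abs_sub _ _
      nlinarith [mul_nonneg hX hm0]
  · push Not at hz
    rw [setIntegral_eq_zero_of_forall_eq_zero fun x hx => by
      rw [hgr x (hz x (hQT hx)), cubeAvg_eq_zero fun y hy => hgr y (hz y hy), sub_zero, abs_zero]]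
    positivity

lemma exists_cubeAvg_mul_sub_le (hd : 0 < d)
    (hgrowth : ∀ Q : Cube d, IsCube μ Q → μ Q.set ≤ ENNReal.ofReal (C₀ * Q.side ^ n))
    (hC₀ : 0 < C₀) (hη : 1 < η) (hρ : 1 < ρ) (hβ : ρ ^ n < β) (hf : LocallyIntegrable f μ)
    (hC : 0 ≤ C) (h : RBMOBound μ n η ρ β f C)
    (hg : Integrable (fun x => f x * φ x) μ) (hL0 : 0 ≤ L)
    (hL : ∀ x y, |φ x - φ y| ≤ L * ‖x - y‖) (hM : ∀ x, |φ x| ≤ M)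
    (hr : ∀ x, r < ‖x‖ → φ x = 0) :
    ∃ K : ℝ, 0 ≤ K ∧ ∀ Q R : Cube d, IsCube μ Q → IsCube μ R → Q.set ⊆ R.set →
      IsDoubling μ ρ β Q → IsDoubling μ ρ β R →
      |cubeAvg μ Q (fun y => f y * φ y) - cubeAvg μ R (fun y => f y * φ y)| ≤
        K * SQR μ n Q R := by
  have hβ0 : 0 < β := (by positivity : 0 < ρ ^ n).trans hβ
  have hM0 : 0 ≤ M := (abs_nonneg _).trans (hM 0)
  have hgr : ∀ x, r < ‖x‖ → f x * φ x = 0 := fun x hx => by rw [hr x hx, mul_zero]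
  obtain ⟨K, hK, hK'⟩ := exists_abs_cubeAvg_mul_sub_le hgrowth hC₀ hη hρ hβ hf hC h
    hg.locallyIntegrable hL0 hL (r + d) hρ
  obtain ⟨F, hF, hF'⟩ := exists_setIntegral_abs_le_of_one_le_side hg hgr hρ
  obtain ⟨G, hG, hG'⟩ := exists_abs_cubeAvg_le_mul_SQR hgrowth hC₀ hρ hβ hf hC h (r + d)
  set g : Euc d → ℝ := fun y => f y * φ y with hgdef
  have hnear : ∀ P : Cube d, P.side ≤ 1 → (∃ x ∈ P.set, ‖x‖ ≤ r) → ∀ y ∈ P.set, ‖y‖ ≤ r + d := by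
    rintro P hP1 ⟨x, hx, hxr⟩ y hy
    have h1 := Cube.norm_sub_le_of_mem hy hx
    have h2 := norm_le_norm_add_norm_sub' y x
    have h3 : (d : ℝ) * P.side ≤ d := mul_le_of_le_one_right (by positivity) hP1
    linarith
  have hsmall : ∀ P : Cube d, IsCube μ P → IsDoubling μ ρ β P → P.side ≤ 1 →
      ‖P.center‖ ≤ r + d → ∀ x ∈ P.set, |cubeAvg μ P f * φ x - cubeAvg μ P g| ≤ K * β := by
    intro P hP hPd hP1 hPr y hy
    refine le_of_mul_le_mul_left ?_ hP.measureReal_pos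
    have h1 := hK' P hP hPr hP1 y hy
    have h2 := mul_le_mul_of_nonneg_left (hPd.measureReal_le hβ0.le) hK
    linarith
  have hlarge : ∀ P : Cube d, IsCube μ P → IsDoubling μ ρ β P → 1 ≤ P.side →
      |cubeAvg μ P g| ≤ F * β := by
    intro P hP hPd hP1
    have h1 := hF' P hP hP1
    have h2 := mul_le_mul_of_nonneg_left (hPd.measureReal_le hβ0.le) hF
    have h3 := measureReal_mul_abs_cubeAvg_le hP (hg.integrableOn (s := P.set))
    refine le_of_mul_le_mul_left ?_ hP.measureReal_pos
    linarith
  refine ⟨M * C + 2 * (K * β) + M * G + 2 * (F * β), by positivity,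
    fun Q R hQ hR hQR hQd hRd => ?_⟩
  have hS := one_le_SQR (μ := μ) (n := n) hQ.1 R
  set S := SQR μ n Q R
  have hKS : K * β ≤ K * β * S := le_mul_of_one_le_right (by positivity) hS
  have hFS : F * β ≤ F * β * S := le_mul_of_one_le_right (by positivity) hS
  have hS0 : 0 ≤ S := by linarith
  have hCS : 0 ≤ M * C * S := by positivity
  have hGS : 0 ≤ M * G * S := by positivity
  have hF0 : 0 ≤ F * β * S := by positivity
  have hK0 : 0 ≤ K * β * S := by positivity
  have hcQ := Cube.center_mem_set hQ.1.le
  rcases le_total R.side 1 with hR1 | hR1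
  · by_cases hzR : ∃ x ∈ R.set, ‖x‖ ≤ r
    · have hside := Cube.side_le_of_subset hd hQ.1.le hQR
      have h1 := hsmall R hR hRd hR1 (hnear R hR1 hzR R.center (Cube.center_mem_set hR.1.le))
        Q.center (hQR hcQ)
      have h2 := hsmall Q hQ hQd (hside.trans hR1) (hnear R hR1 hzR Q.center (hQR hcQ))
        Q.center hcQ
      have h3 := h.2 Q R hQ hR hQR hQd hRd
      have h4 : |cubeAvg μ Q f * φ Q.center - cubeAvg μ R f * φ Q.center| ≤ M * (C * S) := by
        rw [← sub_mul, abs_mul, mul_comm]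
        exact mul_le_mul (hM _) h3 (abs_nonneg _) hM0
      rw [abs_le] at h1 h2 h4 ⊢
      constructor <;> linarith [h1.1, h1.2, h2.1, h2.2, h4.1, h4.2]
    · push Not at hzR
      rw [cubeAvg_eq_zero fun y hy => hgr y (hzR y hy),
        cubeAvg_eq_zero fun y hy => hgr y (hzR y (hQR hy)), sub_zero, abs_zero]
      positivity
  · have hRb := hlarge R hR hRd hR1
    have hQb : |cubeAvg μ Q g| ≤ F * β * S + K * β * S + M * G * S := by
      rcases le_total Q.side 1 with hQ1 | hQ1
      · by_cases hzQ : ∃ x ∈ Q.set, ‖x‖ ≤ r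
        · have hQr := hnear Q hQ1 hzQ Q.center hcQ
          have h1 := hsmall Q hQ hQd hQ1 hQr Q.center hcQ
          have h2 := hG' Q R hQ hQr hQ1 hQd hR1
          have h3 : |cubeAvg μ Q f * φ Q.center| ≤ M * (G * S) := by
            rw [abs_mul, mul_comm]
            exact mul_le_mul (hM _) h2 (abs_nonneg _) hM0
          have h4 := abs_sub_abs_le_abs_sub (cubeAvg μ Q g) (cubeAvg μ Q f * φ Q.center)
          rw [abs_sub_comm] at h4
          linarith
        · push Not at hzQ
          rw [cubeAvg_eq_zero fun y hy => hgr y (hzQ y hy), abs_zero]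
          positivity
      · linarith [hlarge Q hQ hQd hQ1]
    have := abs_sub (cubeAvg μ Q g) (cubeAvg μ R g)
    linarith

end

/-- if `f ∈ RBMO(μ)` and `φ` is `C¹` with compact support, then `fφ ∈ RBMO(μ)`. -/
theorem rbmo_mul_smooth_compact_support
    {d n : ℕ} (μ : Measure (Euc d)) (C₀ η ρ β : ℝ)
    (hn : 0 < n) (hnd : n ≤ d) (hC₀ : 0 < C₀)
    (hgrowth : ∀ x : Euc d, ∀ r : ℝ, 0 < r →
      μ (Metric.ball x r) ≤ ENNReal.ofReal (C₀ * r ^ n))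
    (hgrowthQ : ∀ Q : Cube d, IsCube μ Q → μ Q.set ≤ ENNReal.ofReal (C₀ * Q.side ^ n))
    (hη : 1 < η) (hρ : 1 < ρ) (hβ : ρ ^ n < β)
    (f φ : Euc d → ℝ) (hf : MemRBMO μ n η ρ β f)
    (hφ : ContDiff ℝ 1 φ) (hφc : HasCompactSupport φ) :
    MemRBMO μ n η ρ β (fun x => f x * φ x) := by
  obtain ⟨hfloc, C, hC, hbound⟩ := hf
  have : IsLocallyFiniteMeasure μ := ⟨fun x => ⟨ball x 1, ball_mem_nhds x one_pos,
    (hgrowth x 1 one_pos).trans_lt ENNReal.ofReal_lt_top⟩⟩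
  have hg := integrable_mul_of_hasCompactSupport hfloc hφ.continuous hφc
  obtain ⟨M, hM⟩ := hφ.continuous.bounded_above_of_compact_support hφc
  obtain ⟨L, hL⟩ := hφ.lipschitzWith_of_hasCompactSupport hφc one_ne_zero
  have hL' : ∀ x y, |φ x - φ y| ≤ L * ‖x - y‖ := fun x y => hL.norm_sub_le x y
  obtain ⟨r, hr⟩ := hφc.isCompact.isBounded.subset_closedBall 0
  have hr' : ∀ x, r < ‖x‖ → φ x = 0 := fun x hx => image_eq_zero_of_notMem_tsupport fun hxs =>
    absurd (hr hxs) (by simpa using hx)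
  obtain ⟨K₁, hK₁, h₁⟩ := exists_oscillation_mul_le hgrowthQ hC₀ hη hρ hβ hfloc hC hbound hg
    L.coe_nonneg hL' hM hr'
  obtain ⟨K₂, hK₂, h₂⟩ := exists_cubeAvg_mul_sub_le (hn.trans_le hnd) hgrowthQ hC₀ hη hρ hβ hfloc
    hC hbound hg L.coe_nonneg hL' hM hr'
  refine ⟨hg.locallyIntegrable, K₁ + K₂, add_nonneg hK₁ hK₂, fun Q hQ => ?_,
    fun Q R hQ hR hQR hQd hRd => ?_⟩
  · exact (h₁ Q hQ).trans
      (mul_le_mul_of_nonneg_right (le_add_of_nonneg_right hK₂) measureReal_nonneg)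
  · exact (h₂ Q R hQ hR hQR hQd hRd).trans (mul_le_mul_of_nonneg_right
      (le_add_of_nonneg_left hK₁) (zero_le_one.trans (one_le_SQR hQ.1 R)))
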